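/- arXiv:2604.01731 — 3 statements merged into one kernel-verified Lean document; each statement's English description precedes it below -/
import Mathlib

section
/- Gamma factor of a twisted-linearly distinguished cuspidal representation equals the sign of the period: Let 𝒌 be a finite field with q elements, q odd, n = 2m with m ≥ 1, and R a field of characteristic different from the characteristic p of 𝒌. Fix α ∈ 𝒌^× which is not a square, let H = { [[x, y],[αy, x]] (block form, x,y ∈ M_m(𝒌)) } ∩ GL_{2m}(𝒌) (a subgroup isomorphic to GL_m of the quadratic extension 𝒌(√α)), and let w = diag(1_m, −1_m). Let (π,V) be an absolutely irreducible cuspidal R-representation of GL_{2m}(𝒌), let Λ : V → R be a nonzero H-invariant linear form, and let χ ∈ R with Λ∘π(w) = χ·Λ. Let ψ : (𝒌,+) → R^× be a nontrivial additive character, set Ψ(a) = ψ(trace(a)), and normalize the Fourier transform by F_ψΦ(a) = q^{-2m²}·Σ_{g∈M_{2m}(𝒌)} Φ(g)Ψ(ga). Then for every Φ : M_{2m}(𝒌) → R, v ∈ V, v^∨ ∈ Hom_R(V,R): Z(F_ψΦ, (f_{v,v^∨})^∨) = χ · Z(Φ, f_{v,v^∨}); that is, γ(π,ψ) = χ. 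-/
open Matrix
noncomputable section

namespace Stmt15

variable {k R V : Type*} [Field k] [Fintype k] [DecidableEq k] [Field R]
  [AddCommGroup V] [Module R V] {m : ℕ}

/-- The Godement–Jacquet sum over `GL_{2m}(𝒌)`. -/
def Z (Φ : Matrix (Fin m ⊕ Fin m) (Fin m ⊕ Fin m) k → R)
    (f : GL (Fin m ⊕ Fin m) k → R) : R :=
  ∑ g : GL (Fin m ⊕ Fin m) k, Φ (g : Matrix (Fin m ⊕ Fin m) (Fin m ⊕ Fin m) k) * f g

/-- The matrix coefficient `f_{v,v^∨}(g) = v^∨(π(g) v)`. -/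
def mc (π : Representation R (GL (Fin m ⊕ Fin m) k) V) (v : V) (v' : Module.Dual R V) :
    GL (Fin m ⊕ Fin m) k → R := fun g => v' (π g v)

/-- `f^∨(g) = f(g⁻¹)`. -/
def inve (f : GL (Fin m ⊕ Fin m) k → R) : GL (Fin m ⊕ Fin m) k → R := fun g => f g⁻¹

/-- The Fourier transform on `M_{2m}(𝒌)` with normalization constant `c`. -/
def fourier (c : R) (ψ : AddChar k R)
    (Φ : Matrix (Fin m ⊕ Fin m) (Fin m ⊕ Fin m) k → R) :
    Matrix (Fin m ⊕ Fin m) (Fin m ⊕ Fin m) k → R :=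
  fun a => c * ∑ g : Matrix (Fin m ⊕ Fin m) (Fin m ⊕ Fin m) k,
    Φ g * ψ (Matrix.trace (g * a))

/-- `u` lies in the unipotent radical of the parabolic subgroup determined by `b`. -/
def UnipCond {ι : Type*} [Fintype ι] [DecidableEq ι] {N : ℕ} (b : ι → Fin N)
    (u : GL ι k) : Prop :=
  (∀ i j, b j < b i → (u : Matrix ι ι k) i j = 0) ∧
  (∀ i j, b i = b j → (u : Matrix ι ι k) i j = if i = j then 1 else 0)

/-- Cuspidality: coinvariants vanish for the unipotent radical of every proper parabolic
subgroup. -/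
def IsCuspidal {ι : Type*} [Fintype ι] [DecidableEq ι]
    (π : Representation R (GL ι k) V) : Prop :=
  ∀ (N : ℕ) (b : ι → Fin N), (∃ i j, b i ≠ b j) → ∀ h : GL ι k,
    Submodule.span R {x : V | ∃ u : GL ι k, UnipCond b u ∧
      ∃ v : V, x = v - π (h * u * h⁻¹) v} = ⊤


/-- Membership in the twisted-linear subgroup `H ≃ GL_m(𝒌(√α))` of `GL_{2m}(𝒌)`:
the invertible matrices of block form `[[x, y], [αy, x]]`. -/
def IsTwistedLinear (α : k) (h : GL (Fin m ⊕ Fin m) k) : Prop :=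
  ∃ x y : Matrix (Fin m) (Fin m) k,
    (h : Matrix (Fin m ⊕ Fin m) (Fin m ⊕ Fin m) k) = Matrix.fromBlocks x y (α • y) x

/-- The element `w = diag(1_m, −1_m) ∈ GL_{2m}(𝒌)`. -/
def wDiag : GL (Fin m ⊕ Fin m) k :=
  ⟨Matrix.fromBlocks 1 0 0 (-1), Matrix.fromBlocks 1 0 0 (-1),
    by rw [Matrix.fromBlocks_multiply]
       simp [← Matrix.fromBlocks_one],
    by rw [Matrix.fromBlocks_multiply]
       simp [← Matrix.fromBlocks_one]⟩

set_option linter.unusedSectionVars false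

section Cuspidal

variable {ι : Type*} [Fintype ι] [DecidableEq ι]

/-- A singular matrix is fixed under right multiplication by the unipotent radical of some
proper parabolic subgroup. -/
lemma exists_unipCond_mul_eq [Nontrivial ι] (X : Matrix ι ι k) (hX : ¬ IsUnit X) :
    ∃ b : ι → Fin 2, (∃ i j, b i ≠ b j) ∧ ∃ h : GL ι k, ∀ u : GL ι k, UnipCond b u →
      X * ((h * u * h⁻¹ : GL ι k) : Matrix ι ι k) = X := by
  have hdet : X.det = 0 := by
    by_contra hne
    exact hX ((Matrix.isUnit_iff_isUnit_det X).2 (isUnit_iff_ne_zero.2 hne))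
  obtain ⟨v, hv0, hv⟩ := Matrix.exists_mulVec_eq_zero_iff.2 hdet
  obtain ⟨i₀, hi₀⟩ := Function.ne_iff.1 hv0
  obtain ⟨j₀, hj₀⟩ := exists_ne i₀
  have hunit : IsUnit ((1 : Matrix ι ι k).updateCol i₀ v).det := by
    rw [← Matrix.cramer_apply, Matrix.cramer_one]
    simpa using hi₀
  obtain ⟨h, hh⟩ := (Matrix.isUnit_iff_isUnit_det _).2 hunit
  refine ⟨fun i => if i = i₀ then 0 else 1, ⟨i₀, j₀, by simp [hj₀]⟩, h, fun u hu => ?_⟩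
  have hXh : ∀ i, (X * (h : Matrix ι ι k)) i i₀ = 0 := by
    intro i
    have := congrFun hv i
    simpa [Matrix.mul_apply, hh, Matrix.mulVec, dotProduct] using this
  have hu1 : ∀ i j, i ≠ i₀ → (u : Matrix ι ι k) i j = (1 : Matrix ι ι k) i j := by
    intro i j hi
    by_cases hj : j = i₀
    · subst hj
      rw [hu.1 i j (by simp [hi]), Matrix.one_apply_ne hi]
    · rw [hu.2 i j (by simp [hi, hj]), Matrix.one_apply]
  have hzero : X * (h : Matrix ι ι k) * ((u : Matrix ι ι k) - 1) = 0 := by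
    ext i j
    rw [Matrix.mul_apply]
    refine Finset.sum_eq_zero fun l _ => ?_
    by_cases hl : l = i₀
    · rw [hl, hXh, zero_mul]
    · rw [Matrix.sub_apply, hu1 l j hl, sub_self, mul_zero]
  have hXhu : X * (h : Matrix ι ι k) * (u : Matrix ι ι k) = X * (h : Matrix ι ι k) := by
    rwa [mul_sub, mul_one, sub_eq_zero] at hzero
  rw [Units.val_mul, Units.val_mul, ← mul_assoc, ← mul_assoc, hXhu, mul_assoc, Units.mul_inv,
    mul_one]

/-- A linear map on a cuspidal representation which is invariant under the right stabilizer
of a singular matrix vanishes. -/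
lemma IsCuspidal.eq_zero_of_invariant [Nontrivial ι] {W : Type*} [AddCommGroup W] [Module R W]
    {π : Representation R (GL ι k) V} (hπ : IsCuspidal π) {X : Matrix ι ι k} (hX : ¬ IsUnit X)
    (L : V →ₗ[R] W)
    (hL : ∀ u : GL ι k, X * (u : Matrix ι ι k) = X → ∀ v, L (π u v) = L v) : L = 0 := by
  obtain ⟨b, hb, h, hu⟩ := exists_unipCond_mul_eq X hX
  rw [← LinearMap.ker_eq_top, ← top_le_iff, ← hπ 2 b hb h, Submodule.span_le]
  rintro _ ⟨u, hbu, v, rfl⟩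
  rw [SetLike.mem_coe, LinearMap.mem_ker, map_sub, hL _ (hu u hbu), sub_self]

/-- The operator `∑_g ψ(tr(X g)) π(g⁻¹)`. -/
def gaussOp (π : Representation R (GL ι k) V) (ψ : AddChar k R) (X : Matrix ι ι k) :
    V →ₗ[R] V :=
  ∑ g : GL ι k, ψ (Matrix.trace (X * (g : Matrix ι ι k))) • π g⁻¹

lemma gaussOp_mul (π : Representation R (GL ι k) V) (ψ : AddChar k R) (X : Matrix ι ι k)
    (u : GL ι k) : gaussOp π ψ (X * (u : Matrix ι ι k)) = gaussOp π ψ X * π u := by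
  simp only [gaussOp, Finset.sum_mul, smul_mul_assoc, ← map_mul]
  refine Fintype.sum_equiv (Equiv.mulLeft u) _ _ fun g => ?_
  rw [Equiv.coe_mulLeft, Units.val_mul, mul_assoc, _root_.mul_inv_rev, inv_mul_cancel_right]

lemma gaussOp_one_comm (π : Representation R (GL ι k) V) (ψ : AddChar k R) (u : GL ι k) :
    gaussOp π ψ 1 * π u = π u * gaussOp π ψ 1 := by
  simp only [gaussOp, Finset.sum_mul, Finset.mul_sum, smul_mul_assoc, mul_smul_comm, ← map_mul,
    one_mul]
  refine Fintype.sum_equiv (MulAut.conj u⁻¹).toEquiv _ _ fun g => ?_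
  have : (MulAut.conj u⁻¹).toEquiv g = u⁻¹ * (g * u) := by simp [mul_assoc]
  rw [this, Units.val_mul, Matrix.trace_mul_comm, Units.val_mul, mul_assoc, Units.mul_inv,
    mul_one]
  simp [mul_assoc]

lemma gaussOp_eq_zero [Nontrivial ι] {π : Representation R (GL ι k) V} (hπ : IsCuspidal π)
    (ψ : AddChar k R) {X : Matrix ι ι k} (hX : ¬ IsUnit X) : gaussOp π ψ X = 0 :=
  hπ.eq_zero_of_invariant hX _ fun u hu v => by
    conv_rhs => rw [← hu, gaussOp_mul]
    rfl

lemma sum_matrix_eq_sum_gl {M : Type*} [AddCommMonoid M] (F : Matrix ι ι k → M)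
    (hF : ∀ X, ¬ IsUnit X → F X = 0) : ∑ X, F X = ∑ g : GL ι k, F g :=
  (Fintype.sum_of_injective (fun g : GL ι k => (g : Matrix ι ι k)) Units.val_injective _ _
    (fun X hX => hF X fun ⟨g, hg⟩ => hX ⟨g, hg⟩) fun _ => rfl).symm

end Cuspidal

/-- The Godement–Jacquet functional equation, when the Gauss operator is the scalar `γ`. -/
lemma Z_fourier [Nontrivial (Fin m ⊕ Fin m)] {π : Representation R (GL (Fin m ⊕ Fin m) k) V}
    (hπ : IsCuspidal π) (ψ : AddChar k R) (c γ : R) (hγ : gaussOp π ψ 1 = γ • LinearMap.id)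
    (Φ : Matrix (Fin m ⊕ Fin m) (Fin m ⊕ Fin m) k → R) (v : V) (v' : Module.Dual R V) :
    Z (fourier c ψ Φ) (inve (mc π v v')) = c * γ * Z Φ (mc π v v') := by
  have hZ : Z (fourier c ψ Φ) (inve (mc π v v')) =
      c * ∑ X, Φ X * v' (gaussOp π ψ X v) := by
    simp only [Z, fourier, inve, mc, gaussOp, LinearMap.sum_apply, LinearMap.smul_apply, map_sum,
      map_smul, smul_eq_mul, Finset.mul_sum, Finset.sum_mul]
    rw [Finset.sum_comm]
    simp only [mul_assoc]
  rw [hZ, sum_matrix_eq_sum_gl _ fun X hX => by simp [gaussOp_eq_zero hπ ψ hX], mul_assoc, Z,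
    Finset.mul_sum (a := γ)]
  congr 1
  refine Finset.sum_congr rfl fun g _ => ?_
  have := gaussOp_mul π ψ 1 g
  rw [one_mul] at this
  rw [this, hγ]
  simp [mc, mul_left_comm]

section Period

/-- The matrix `[[0, 1], [α, 0]]`, whose centralizer is `M_m(𝒌(√α))`. -/
def twistMatrix (m : ℕ) (α : k) : Matrix (Fin m ⊕ Fin m) (Fin m ⊕ Fin m) k :=
  Matrix.fromBlocks 0 1 (α • 1) 0

lemma commute_twistMatrix_iff (α : k) (X : Matrix (Fin m ⊕ Fin m) (Fin m ⊕ Fin m) k) :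
    Commute X (twistMatrix m α) ↔
      ∃ x y : Matrix (Fin m) (Fin m) k, X = Matrix.fromBlocks x y (α • y) x := by
  constructor
  · intro h
    rw [← Matrix.fromBlocks_toBlocks X] at h ⊢
    simp only [Commute, SemiconjBy, twistMatrix, Matrix.fromBlocks_multiply,
      Matrix.fromBlocks_inj] at h
    refine ⟨X.toBlocks₁₁, X.toBlocks₁₂, ?_⟩
    rw [Matrix.fromBlocks_inj]
    have h1 := h.1
    have h2 := h.2.1
    simp at h1 h2
    exact ⟨rfl, rfl, h1.symm, h2.symm⟩
  · rintro ⟨x, y, rfl⟩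
    simp [Commute, SemiconjBy, twistMatrix, Matrix.fromBlocks_multiply]

/-- The subgroup `H ≃ GL_m(𝒌(√α))` of `GL_{2m}(𝒌)`. -/
def twistedSubgroup (m : ℕ) (α : k) : Subgroup (GL (Fin m ⊕ Fin m) k) where
  carrier := {g | Commute (g : Matrix (Fin m ⊕ Fin m) (Fin m ⊕ Fin m) k) (twistMatrix m α)}
  mul_mem' ha hb := by
    simpa using Commute.mul_left ha hb
  one_mem' := by simp
  inv_mem' h := Commute.units_inv_left h

lemma mem_twistedSubgroup {α : k} {g : GL (Fin m ⊕ Fin m) k} : g ∈ twistedSubgroup m α ↔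
    Commute (g : Matrix (Fin m ⊕ Fin m) (Fin m ⊕ Fin m) k) (twistMatrix m α) := Iff.rfl

open Classical in
/-- The sum of `ψ(tr(A X))` over those `X ∈ M_m(𝒌(√α))` satisfying `P`. -/
def twistedSum (ψ : AddChar k R) (α : k)
    (P : Matrix (Fin m ⊕ Fin m) (Fin m ⊕ Fin m) k → Prop)
    (A : Matrix (Fin m ⊕ Fin m) (Fin m ⊕ Fin m) k) : R :=
  ∑ X with Commute X (twistMatrix m α) ∧ P X, ψ (Matrix.trace (A * X))

lemma twistedSum_def (ψ : AddChar k R) (α : k)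
    (P : Matrix (Fin m ⊕ Fin m) (Fin m ⊕ Fin m) k → Prop)
    [DecidablePred fun X => Commute X (twistMatrix m α) ∧ P X]
    (A : Matrix (Fin m ⊕ Fin m) (Fin m ⊕ Fin m) k) :
    twistedSum ψ α P A =
      ∑ X with Commute X (twistMatrix m α) ∧ P X, ψ (Matrix.trace (A * X)) :=
  Finset.sum_congr (by ext; simp) fun _ _ => rfl

lemma twistedSum_mul_right (ψ : AddChar k R) {α : k}
    {P : Matrix (Fin m ⊕ Fin m) (Fin m ⊕ Fin m) k → Prop}
    (hP : ∀ (h : GL (Fin m ⊕ Fin m) k) X, P (h * X) ↔ P X)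
    (A : Matrix (Fin m ⊕ Fin m) (Fin m ⊕ Fin m) k) {h : GL (Fin m ⊕ Fin m) k}
    (hh : h ∈ twistedSubgroup m α) :
    twistedSum ψ α P (A * h) = twistedSum ψ α P A := by
  classical
  refine Finset.sum_equiv (Units.mulLeft h) (fun X => ?_) fun X _ => ?_
  · simp only [Finset.mem_filter, Finset.mem_univ, true_and, Units.mulLeft_apply, hP]
    refine and_congr_left fun _ => ⟨fun hX => Commute.mul_left hh hX, fun hX => ?_⟩
    have := Commute.mul_left (Commute.units_inv_left (a := twistMatrix m α) hh) hX
    rwa [Units.inv_mul_cancel_left] at this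
  · rw [Units.mulLeft_apply, mul_assoc]

lemma trace_fromBlocks_eq (a b c d : Matrix (Fin m) (Fin m) k) :
    Matrix.trace (Matrix.fromBlocks a b c d) = Matrix.trace a + Matrix.trace d := by
  simp [Matrix.trace, Fintype.sum_sum_type]

lemma trace_mul_fromBlocks (α : k) (A : Matrix (Fin m ⊕ Fin m) (Fin m ⊕ Fin m) k)
    (x y : Matrix (Fin m) (Fin m) k) :
    Matrix.trace (A * Matrix.fromBlocks x y (α • y) x) =
      Matrix.trace ((A.toBlocks₁₁ + A.toBlocks₂₂) * x) +
        Matrix.trace ((α • A.toBlocks₁₂ + A.toBlocks₂₁) * y) := by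
  conv_lhs => rw [← Matrix.fromBlocks_toBlocks A]
  rw [Matrix.fromBlocks_multiply, trace_fromBlocks_eq]
  simp only [Matrix.trace_add, add_mul, Matrix.mul_smul, Matrix.smul_mul]
  ring

lemma sum_addChar_trace_mul {ι : Type*} [Fintype ι] [DecidableEq ι] {ψ : AddChar k R}
    (hψ : ∃ x, ψ x ≠ 1) (B : Matrix ι ι k) :
    ∑ x, ψ (Matrix.trace (B * x)) =
      if B = 0 then (Fintype.card k : R) ^ (Fintype.card ι * Fintype.card ι) else 0 := by
  classical
  have key := AddChar.sum_eq_ite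
    (ψ.compAddMonoidHom ((Matrix.traceAddMonoidHom ι k).comp (AddMonoidHom.mulLeft B)))
  simp only [AddChar.compAddMonoidHom_apply, AddMonoidHom.comp_apply,
    AddMonoidHom.coe_mulLeft, Matrix.traceAddMonoidHom_apply] at key
  rw [key]
  have hiff : ψ.compAddMonoidHom ((Matrix.traceAddMonoidHom ι k).comp (AddMonoidHom.mulLeft B)) = 0
      ↔ B = 0 := by
    constructor
    · intro h
      rw [Matrix.ext_iff_trace_mul_right]
      intro x
      rw [zero_mul, Matrix.trace_zero]
      by_contra hne
      obtain ⟨a, ha⟩ := hψ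
      refine ha ?_
      have := DFunLike.congr_fun h ((a / Matrix.trace (B * x)) • x)
      simpa [AddChar.compAddMonoidHom_apply, Matrix.trace_smul, hne] using this
    · rintro rfl
      ext x
      simp [AddChar.compAddMonoidHom_apply]
  simp only [hiff]
  split_ifs
  · rw [← Fintype.card_congr (Matrix.of (m := ι) (n := ι) (α := k)), Fintype.card_fun,
      Fintype.card_fun, Nat.cast_pow, Nat.cast_pow, pow_mul]
  · rfl

lemma commute_wDiag_mul_iff (α : k) (A : Matrix (Fin m ⊕ Fin m) (Fin m ⊕ Fin m) k) :
    Commute ((wDiag : GL (Fin m ⊕ Fin m) k) * A) (twistMatrix m α) ↔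
      A.toBlocks₁₁ + A.toBlocks₂₂ = 0 ∧ α • A.toBlocks₁₂ + A.toBlocks₂₁ = 0 := by
  have hw : ((wDiag : GL (Fin m ⊕ Fin m) k) : Matrix _ _ k) * A =
      Matrix.fromBlocks A.toBlocks₁₁ A.toBlocks₁₂ (-A.toBlocks₂₁) (-A.toBlocks₂₂) := by
    conv_lhs => rw [← Matrix.fromBlocks_toBlocks A]
    simp [wDiag, Matrix.fromBlocks_multiply]
  rw [commute_twistMatrix_iff, hw]
  constructor
  · rintro ⟨x, y, h⟩
    obtain ⟨h1, h2, h3, h4⟩ := Matrix.fromBlocks_inj.1 h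
    rw [h1, h2, ← h3, ← h4]
    simp
  · rintro ⟨h1, h2⟩
    exact ⟨A.toBlocks₁₁, A.toBlocks₁₂, by
      rw [Matrix.fromBlocks_inj]
      exact ⟨rfl, rfl, (eq_neg_of_add_eq_zero_left h2).symm, (eq_neg_of_add_eq_zero_left h1).symm⟩⟩

open Classical in
/-- The Fourier transform of the indicator function of `M_m(𝒌(√α))`. -/
lemma twistedSum_true {ψ : AddChar k R} (hψ : ∃ x, ψ x ≠ 1) (α : k)
    (A : Matrix (Fin m ⊕ Fin m) (Fin m ⊕ Fin m) k) :
    twistedSum ψ α (fun _ => True) A =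
      if Commute ((wDiag : GL (Fin m ⊕ Fin m) k) * A) (twistMatrix m α)
      then (Fintype.card k : R) ^ (2 * m ^ 2) else 0 := by
  let e : Matrix (Fin m) (Fin m) k × Matrix (Fin m) (Fin m) k →
      Matrix (Fin m ⊕ Fin m) (Fin m ⊕ Fin m) k :=
    fun p => Matrix.fromBlocks p.1 p.2 (α • p.2) p.1
  have hsum : twistedSum ψ α (fun _ => True) A = ∑ p, ψ (Matrix.trace (A * e p)) := by
    rw [twistedSum_def]
    refine (Finset.sum_bij (fun p _ => e p) (fun p _ => ?_) (fun p _ p' _ h => ?_)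
      (fun X hX => ?_) fun _ _ => rfl).symm
    · simpa using (commute_twistMatrix_iff α _).2 ⟨p.1, p.2, rfl⟩
    · obtain ⟨h1, h2, -, -⟩ := Matrix.fromBlocks_inj.1 h
      exact Prod.ext h1 h2
    · obtain ⟨x, y, h⟩ := (commute_twistMatrix_iff α X).1 (Finset.mem_filter.1 hX).2.1
      exact ⟨(x, y), Finset.mem_univ _, h.symm⟩
  simp only [hsum, e, trace_mul_fromBlocks, AddChar.map_add_eq_mul, Fintype.sum_prod_type,
    ← Finset.mul_sum, ← Finset.sum_mul, sum_addChar_trace_mul hψ, commute_wDiag_mul_iff]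
  split_ifs <;> simp_all [← pow_add, two_mul, pow_two]

/-- The linear form `∑_{g ∈ G/H} (∑_X ψ(tr(g X))) Λ(π(g⁻¹) v)`, with `X` ranging over the
elements of `M_m(𝒌(√α))` satisfying `P`. -/
def periodSum (π : Representation R (GL (Fin m ⊕ Fin m) k) V) (Λ : Module.Dual R V)
    (ψ : AddChar k R) (α : k) (P : Matrix (Fin m ⊕ Fin m) (Fin m ⊕ Fin m) k → Prop) :
    Module.Dual R V :=
  let _ := Fintype.ofFinite (GL (Fin m ⊕ Fin m) k ⧸ twistedSubgroup m α)
  ∑ x : GL (Fin m ⊕ Fin m) k ⧸ twistedSubgroup m α,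
    twistedSum ψ α P (x.out : GL (Fin m ⊕ Fin m) k) • (Λ ∘ₗ π x.out⁻¹)

lemma periodSum_apply [Fintype (GL (Fin m ⊕ Fin m) k ⧸ twistedSubgroup m α)]
    (π : Representation R (GL (Fin m ⊕ Fin m) k) V) (Λ : Module.Dual R V)
    (ψ : AddChar k R) (P : Matrix (Fin m ⊕ Fin m) (Fin m ⊕ Fin m) k → Prop) (v : V) :
    periodSum π Λ ψ α P v = ∑ x : GL (Fin m ⊕ Fin m) k ⧸ twistedSubgroup m α,
      twistedSum ψ α P (x.out : GL (Fin m ⊕ Fin m) k) * Λ (π x.out⁻¹ v) := by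
  simp only [periodSum, LinearMap.sum_apply, LinearMap.smul_apply, smul_eq_mul,
    LinearMap.comp_apply]
  refine Finset.sum_congr (by ext; simp) fun _ _ => rfl

variable {π : Representation R (GL (Fin m ⊕ Fin m) k) V} {Λ : Module.Dual R V} {α : k}

lemma periodSum_translate (hinv : ∀ h ∈ twistedSubgroup m α, ∀ v : V, Λ (π h v) = Λ v)
    (ψ : AddChar k R) {P : Matrix (Fin m ⊕ Fin m) (Fin m ⊕ Fin m) k → Prop}
    (hP : ∀ (h : GL (Fin m ⊕ Fin m) k) X, P (h * X) ↔ P X) {u : GL (Fin m ⊕ Fin m) k}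
    (hu : ∀ X, P X → X * (u : Matrix (Fin m ⊕ Fin m) (Fin m ⊕ Fin m) k) = X) (v : V) :
    periodSum π Λ ψ α P (π u v) = periodSum π Λ ψ α P v := by
  classical
  let _ := Fintype.ofFinite (GL (Fin m ⊕ Fin m) k ⧸ twistedSubgroup m α)
  let F : GL (Fin m ⊕ Fin m) k → R := fun g => twistedSum ψ α P g * Λ (π g⁻¹ v)
  have hF : ∀ g g' : GL (Fin m ⊕ Fin m) k,
      (g : GL (Fin m ⊕ Fin m) k ⧸ twistedSubgroup m α) = g' → F g = F g' := by
    intro g g' h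
    have hmem := QuotientGroup.eq.1 h
    obtain ⟨t, ht⟩ : ∃ t, t = g⁻¹ * g' := ⟨_, rfl⟩
    rw [← ht] at hmem
    obtain rfl : g' = g * t := by simp [ht]
    simp only [F]
    rw [Units.val_mul, twistedSum_mul_right ψ hP _ hmem, _root_.mul_inv_rev, map_mul,
      Module.End.mul_apply, hinv _ (inv_mem hmem)]
  have hleft : ∀ A : Matrix (Fin m ⊕ Fin m) (Fin m ⊕ Fin m) k,
      twistedSum ψ α P (((u⁻¹ : GL (Fin m ⊕ Fin m) k) : Matrix _ _ k) * A) =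
        twistedSum ψ α P A := by
    intro A
    refine Finset.sum_congr rfl fun X hX => ?_
    have hXu : X * ((u⁻¹ : GL (Fin m ⊕ Fin m) k) : Matrix _ _ k) = X := by
      rw [Units.mul_inv_eq_iff_eq_mul, hu X (Finset.mem_filter.1 hX).2.2]
    rw [mul_assoc, Matrix.trace_mul_comm, mul_assoc, hXu]
  rw [periodSum_apply, periodSum_apply]
  refine Fintype.sum_equiv (MulAction.toPerm u⁻¹) _ _ fun x => ?_
  trans F (u⁻¹ * x.out)
  · simp only [F]
    rw [Units.val_mul, hleft, _root_.mul_inv_rev, inv_inv, map_mul, Module.End.mul_apply]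
  · refine hF _ _ ?_
    rw [MulAction.toPerm_apply, QuotientGroup.out_eq']
    conv_rhs => rw [← QuotientGroup.out_eq' x]
    rfl

lemma periodSum_isUnit (hinv : ∀ h ∈ twistedSubgroup m α, ∀ v : V, Λ (π h v) = Λ v)
    (ψ : AddChar k R) (v : V) :
    periodSum π Λ ψ α IsUnit v = Λ (gaussOp π ψ 1 v) := by
  classical
  let _ := Fintype.ofFinite (GL (Fin m ⊕ Fin m) k ⧸ twistedSubgroup m α)
  simp only [periodSum_apply, gaussOp, LinearMap.sum_apply, LinearMap.smul_apply, map_sum,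
    map_smul, smul_eq_mul, one_mul]
  rw [← Finset.sum_fiberwise _
    fun g : GL (Fin m ⊕ Fin m) k => (g : GL (Fin m ⊕ Fin m) k ⧸ twistedSubgroup m α)]
  refine Finset.sum_congr rfl fun x _ => ?_
  rw [twistedSum_def, Finset.sum_mul]
  have hmem : ∀ g : GL (Fin m ⊕ Fin m) k,
      (g : GL (Fin m ⊕ Fin m) k ⧸ twistedSubgroup m α) = x →
        x.out⁻¹ * g ∈ twistedSubgroup m α := by
    intro g hg
    rw [← QuotientGroup.eq, QuotientGroup.out_eq', hg]
  refine (Finset.sum_bij (fun g _ => ((x.out⁻¹ * g : GL (Fin m ⊕ Fin m) k) : Matrix _ _ k))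
    (fun g hg => ?_) (fun g _ g' _ h => ?_)
    (fun X hX => ?_) fun g hg => ?_).symm
  · simp only [Finset.mem_filter, Finset.mem_univ, true_and]
    exact ⟨hmem g (Finset.mem_filter.1 hg).2, Units.isUnit _⟩
  · exact mul_left_cancel (a := x.out⁻¹) (Units.ext h)
  · obtain ⟨hc, t, rfl⟩ := (Finset.mem_filter.1 hX).2
    refine ⟨x.out * t, ?_, by simp⟩
    rw [Finset.mem_filter]
    refine ⟨Finset.mem_univ _, ?_⟩
    conv_rhs => rw [← QuotientGroup.out_eq' x]
    rw [eq_comm, QuotientGroup.eq, inv_mul_cancel_left]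
    exact hc
  · rw [Units.val_mul, Units.mul_inv_cancel_left]
    congr 1
    rw [← hinv _ (hmem g (Finset.mem_filter.1 hg).2), ← Module.End.mul_apply, ← map_mul, mul_inv_cancel_right]

lemma periodSum_not_isUnit [Nontrivial (Fin m ⊕ Fin m)] (hπ : IsCuspidal π)
    (hinv : ∀ h ∈ twistedSubgroup m α, ∀ v : V, Λ (π h v) = Λ v)
    (ψ : AddChar k R) : periodSum π Λ ψ α (fun X => ¬ IsUnit X) = 0 := by
  classical
  let _ := Fintype.ofFinite (GL (Fin m ⊕ Fin m) k ⧸ twistedSubgroup m α)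
  let κ : Matrix (Fin m ⊕ Fin m) (Fin m ⊕ Fin m) k →
      Finset (Matrix (Fin m ⊕ Fin m) (Fin m ⊕ Fin m) k) := fun X => {Y | X * Y = X}
  have hκ : ∀ (h : GL (Fin m ⊕ Fin m) k) X, κ (h * X) = κ X := by
    intro h X
    ext Y
    simp only [κ, Finset.mem_filter, Finset.mem_univ, true_and, mul_assoc]
    exact Units.mul_right_inj h
  have hsplit : periodSum π Λ ψ α (fun X => ¬ IsUnit X) =
      ∑ K, periodSum π Λ ψ α (fun X => ¬ IsUnit X ∧ κ X = K) := by
    ext v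
    rw [LinearMap.sum_apply]
    simp only [periodSum_apply]
    rw [Finset.sum_comm]
    refine Finset.sum_congr rfl fun x _ => ?_
    rw [← Finset.sum_mul, twistedSum_def, ← Finset.sum_fiberwise _ κ]
    simp only [twistedSum_def, Finset.filter_filter, and_assoc]
  rw [hsplit]
  refine Finset.sum_eq_zero fun K _ => ?_
  by_cases hK : ∃ X, ¬ IsUnit X ∧ κ X = K
  · obtain ⟨X₀, hX₀, rfl⟩ := hK
    refine hπ.eq_zero_of_invariant hX₀ _ fun u hu v => periodSum_translate hinv ψ
      (fun h X => by rw [hκ, Units.isUnit_units_mul]) (fun X hX => ?_) v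
    have : (u : Matrix (Fin m ⊕ Fin m) (Fin m ⊕ Fin m) k) ∈ κ X := by
      rw [hX.2]
      simpa [κ] using hu
    simpa [κ] using this
  · ext v
    rw [periodSum_apply, LinearMap.zero_apply]
    refine Finset.sum_eq_zero fun x _ => ?_
    rw [twistedSum_def, Finset.filter_false_of_mem fun X _ h => hK ⟨X, h.2⟩, Finset.sum_empty,
      zero_mul]

lemma periodSum_true (hinv : ∀ h ∈ twistedSubgroup m α, ∀ v : V, Λ (π h v) = Λ v)
    {ψ : AddChar k R} (hψ : ∃ x, ψ x ≠ 1) (v : V) :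
    periodSum π Λ ψ α (fun _ => True) v =
      (Fintype.card k : R) ^ (2 * m ^ 2) * Λ (π wDiag v) := by
  classical
  let _ := Fintype.ofFinite (GL (Fin m ⊕ Fin m) k ⧸ twistedSubgroup m α)
  have hw : (wDiag : GL (Fin m ⊕ Fin m) k)⁻¹ = wDiag := Units.ext rfl
  have hmem : ∀ x : GL (Fin m ⊕ Fin m) k ⧸ twistedSubgroup m α,
      Commute ((wDiag : GL (Fin m ⊕ Fin m) k) *
        ((x.out : GL (Fin m ⊕ Fin m) k) : Matrix (Fin m ⊕ Fin m) (Fin m ⊕ Fin m) k))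
        (twistMatrix m α) ↔ x = (wDiag : GL (Fin m ⊕ Fin m) k) := by
    intro x
    rw [← Units.val_mul, ← mem_twistedSubgroup]
    nth_rw 1 [← hw]
    rw [← QuotientGroup.eq, QuotientGroup.out_eq', eq_comm]
  simp only [periodSum_apply, twistedSum_true hψ, hmem, ite_mul, zero_mul, Finset.sum_ite_eq',
    Finset.mem_univ, if_true]
  congr 1
  obtain ⟨t, ht⟩ := QuotientGroup.mk_out_eq_mul (twistedSubgroup m α) (wDiag)
  rw [ht, _root_.mul_inv_rev, hw, map_mul, Module.End.mul_apply, hinv _ (inv_mem t.2)]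

/-- The period of the Gauss operator. -/
lemma apply_gaussOp_one [Nontrivial (Fin m ⊕ Fin m)] (hπ : IsCuspidal π)
    (hinv : ∀ h ∈ twistedSubgroup m α, ∀ v : V, Λ (π h v) = Λ v)
    {ψ : AddChar k R} (hψ : ∃ x, ψ x ≠ 1) (v : V) :
    Λ (gaussOp π ψ 1 v) = (Fintype.card k : R) ^ (2 * m ^ 2) * Λ (π wDiag v) := by
  classical
  let _ := Fintype.ofFinite (GL (Fin m ⊕ Fin m) k ⧸ twistedSubgroup m α)
  have hadd : periodSum π Λ ψ α (fun _ => True) =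
      periodSum π Λ ψ α IsUnit + periodSum π Λ ψ α (fun X => ¬ IsUnit X) := by
    ext v
    simp only [LinearMap.add_apply, periodSum_apply, ← Finset.sum_add_distrib, ← add_mul]
    refine Finset.sum_congr rfl fun x _ => ?_
    congr 1
    simp only [twistedSum_def, and_true, ← Finset.filter_filter]
    exact (Finset.sum_filter_add_sum_filter_not _ _ _).symm
  rw [← periodSum_true hinv hψ, ← periodSum_isUnit hinv, hadd, periodSum_not_isUnit hπ hinv,
    add_zero]

end Period

lemma card_cast_ne_zero (hchar : ringChar R ≠ ringChar k) : (Fintype.card k : R) ≠ 0 := by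
  obtain ⟨n, hp, hn⟩ := FiniteField.card k (ringChar k)
  rw [hn, Nat.cast_pow]
  refine pow_ne_zero _ fun h => hchar ?_
  exact ((Nat.dvd_prime hp).1 (ringChar.dvd h)).resolve_left CharP.ringChar_ne_one

/-- **Gamma factor of a twisted-linearly distinguished cuspidal representation equals
the sign of the period.**  For `q` odd, `α ∈ 𝒌^×` a non-square, `π` absolutely
irreducible cuspidal on `GL_{2m}(𝒌)`, `Λ ≠ 0` invariant under `H ≃ GL_m(𝒌(√α))` with
`Λ∘π(w) = χ·Λ` for `w = diag(1_m, −1_m)`, and `ψ` nontrivial: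
`Z(F_ψΦ, (f_{v,v^∨})^∨) = χ · Z(Φ, f_{v,v^∨})`, the Fourier transform being normalized
by `q^{-2m²}`. -/
theorem twisted_linear_distinguished_gamma (hm : 1 ≤ m)
    (hq : Odd (Fintype.card k)) (hchar : ringChar R ≠ ringChar k)
    (α : k) (hα0 : α ≠ 0) (hα : ¬ IsSquare α)
    (π : Representation R (GL (Fin m ⊕ Fin m) k) V)
    (hV : ∃ v : V, v ≠ 0)
    (hirr : ∀ W : Submodule R V, (∀ (g : GL (Fin m ⊕ Fin m) k), ∀ v ∈ W, π g v ∈ W) →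
      W = ⊥ ∨ W = ⊤)
    (hschur : ∀ φ : V →ₗ[R] V, (∀ g : GL (Fin m ⊕ Fin m) k, φ ∘ₗ π g = π g ∘ₗ φ) →
      ∃ c : R, φ = c • LinearMap.id)
    (hcusp : IsCuspidal π)
    (Λ : Module.Dual R V) (hΛ : Λ ≠ 0)
    (hinv : ∀ h : GL (Fin m ⊕ Fin m) k, IsTwistedLinear α h →
      ∀ v : V, Λ (π h v) = Λ v)
    (χ : R) (hχ : ∀ v : V, Λ (π wDiag v) = χ * Λ v)
    (ψ : AddChar k R) (hψ : ∃ x, ψ x ≠ 1)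
    (Φ : Matrix (Fin m ⊕ Fin m) (Fin m ⊕ Fin m) k → R) (v : V)
    (v' : Module.Dual R V) :
    Z (fourier (Ring.inverse ((Fintype.card k : R) ^ (2 * m ^ 2))) ψ Φ)
        (inve (mc π v v'))
      = χ * Z Φ (mc π v v') := by
  have : Nontrivial (Fin m ⊕ Fin m) := ⟨Sum.inl ⟨0, hm⟩, Sum.inr ⟨0, hm⟩, Sum.inl_ne_inr⟩
  have hinv' : ∀ h ∈ twistedSubgroup m α, ∀ v : V, Λ (π h v) = Λ v := fun h hh =>
    hinv h ((commute_twistMatrix_iff α _).1 hh)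
  obtain ⟨γ, hγ⟩ := hschur (gaussOp π ψ 1) (gaussOp_one_comm π ψ)
  have hγχ : γ = (Fintype.card k : R) ^ (2 * m ^ 2) * χ := by
    obtain ⟨v₀, hv₀⟩ : ∃ v₀, Λ v₀ ≠ 0 := by
      by_contra! h
      exact hΛ (LinearMap.ext h)
    have := apply_gaussOp_one hcusp hinv' hψ v₀
    rw [hγ, hχ, LinearMap.smul_apply, LinearMap.id_apply, map_smul, smul_eq_mul,
      ← mul_assoc] at this
    exact mul_right_cancel₀ hv₀ this
  have hq0 : (Fintype.card k : R) ^ (2 * m ^ 2) ≠ 0 := pow_ne_zero _ (card_cast_ne_zero hchar)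
  rw [Z_fourier hcusp ψ _ γ hγ, hγχ, ← mul_assoc, Ring.inverse_mul_cancel _ hq0.isUnit, one_mul]

end Stmt15
end
end

section
/- Gauss sum of a character trivial on the subfield of a quadratic extension: Let E/F be a quadratic extension of finite fields with |F| = Q odd, and let R be a field of characteristic different from the characteristic of F. Let ξ : E^× → R^× be a nontrivial group homomorphism whose restriction to F^× is trivial, let ψ : (F,+) → R^× be a nontrivial additive character, and let δ ∈ E^× satisfy Tr_{E/F}(δ) = 0. Then Σ_{x∈E^×} ξ(x)^{-1}·ψ(Tr_{E/F}(x)) = Q·ξ(δ), where Q denotes the image of |F| in R. -/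
noncomputable section

/-- An element of trace zero in a quadratic algebra squares to minus its norm. -/
theorem sq_eq_algebraMap_of_trace_eq_zero {F E : Type*} [Field F] [Field E] [Algebra F E]
    (hquad : Module.finrank F E = 2) {x : E} (hx : Algebra.trace F E x = 0) :
    x ^ 2 = algebraMap F E (-Algebra.norm F x) := by
  have : Module.Finite F E := Module.finite_of_finrank_eq_succ hquad
  let b := Module.finBasisOfFinrankEq F E hquad
  apply Algebra.leftMulMatrix_injective b
  rw [AlgHom.commutes, map_pow, Algebra.norm_eq_matrix_det b]
  rw [Algebra.trace_eq_matrix_trace b, Matrix.trace_fin_two] at hx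
  generalize Algebra.leftMulMatrix b x = M at *
  have h : M 1 1 = -M 0 0 := by linear_combination hx
  ext i j
  fin_cases i <;> fin_cases j <;>
    simp [pow_two, Matrix.mul_apply, Fin.sum_univ_two, Matrix.det_fin_two,
      Matrix.algebraMap_matrix_apply, h] <;> ring

/-- In a separable quadratic extension the trace-zero elements form a line. -/
theorem exists_smul_eq_of_trace_eq_zero {F E : Type*} [Field F] [Field E] [Algebra F E]
    [Algebra.IsSeparable F E] (hquad : Module.finrank F E = 2) {x y : E} (hx0 : x ≠ 0)
    (hx : Algebra.trace F E x = 0) (hy : Algebra.trace F E y = 0) : ∃ c : F, c • x = y := by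
  have : Module.Finite F E := Module.finite_of_finrank_eq_succ hquad
  have hker : Module.finrank F (LinearMap.ker (Algebra.trace F E)) = 1 := by
    have h := LinearMap.finrank_range_add_finrank_ker (Algebra.trace F E)
    rw [LinearMap.range_eq_top.mpr (Algebra.trace_surjective F E), finrank_top,
      Module.finrank_self, hquad] at h
    omega
  obtain ⟨c, hc⟩ := (finrank_eq_one_iff_of_nonzero' (⟨x, hx⟩ : LinearMap.ker (Algebra.trace F E))
    (by simpa [Subtype.ext_iff] using hx0)).mp hker ⟨y, hy⟩
  exact ⟨c, congrArg Subtype.val hc⟩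

/-- Summing a nontrivial additive character over the nonzero multiples of `t`. -/
theorem AddChar.sum_units_mul {F R : Type*} [Field F] [Fintype F] [DecidableEq F] [Field R]
    {ψ : AddChar F R} (hψ : ψ ≠ 1) (t : F) :
    ∑ u : Fˣ, ψ (u * t) = (if t = 0 then (Fintype.card F : R) else 0) - 1 := by
  have h := AddChar.sum_mulShift t (AddChar.IsPrimitive.of_ne_one hψ)
  rw [Fintype.sum_eq_add_sum_subtype_ne _ 0, zero_mul, AddChar.map_zero_eq_one,
    ← unitsEquivNeZero.sum_comp] at h
  push_cast at h
  exact eq_sub_of_add_eq' h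

/-- A sum over a finite group, arranged along the cosets of the image of an injective map. -/
theorem sum_eq_sum_quotient_range {G H M : Type*} [Group G] [Group H] [Fintype G] [Fintype H]
    [AddCommMonoid M] {i : H →* G} (hi : Function.Injective i) [Fintype (G ⧸ i.range)]
    (f : G → M) : ∑ x, f x = ∑ q : G ⧸ i.range, ∑ h : H, f (q.out * i h) := by
  rw [← Fintype.sum_prod_type' (fun (q : G ⧸ i.range) h ↦ f (q.out * i h))]
  refine (Fintype.sum_bijective (fun p : (G ⧸ i.range) × H ↦ p.1.out * i p.2)
    ⟨?_, ?_⟩ _ _ fun _ ↦ rfl).symm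
  · rintro ⟨q, h⟩ ⟨q', h'⟩ hqh
    have hq : q = q' := by
      have := congrArg (QuotientGroup.mk (s := i.range)) hqh
      simpa using this
    subst hq
    simpa [hi.eq_iff] using hqh
  · intro x
    obtain ⟨⟨_, h, rfl⟩, hx⟩ := QuotientGroup.mk_out_eq_mul i.range x
    exact ⟨(x, h⁻¹), by simp [hx]⟩

/-- **Gauss sum of a character trivial on the subfield of a quadratic extension.**
Let `E/F` be a quadratic extension of finite fields with `|F| = Q` odd and `R` a field of
characteristic different from that of `F`.  If `ξ : E^× → R^×` is a nontrivial character
trivial on `F^×`, `ψ` a nontrivial additive character of `F`, and `δ ∈ E^×` has trace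
zero, then `Σ_{x∈E^×} ξ(x)⁻¹ ψ(Tr_{E/F}(x)) = Q · ξ(δ)`. -/
theorem gauss_sum_of_character_trivial_on_subfield
    {F E R : Type*} [Field F] [Field E] [Algebra F E] [Fintype F] [Fintype E] [DecidableEq E] [Field R]
    (hquad : Module.finrank F E = 2) (hodd : Odd (Fintype.card F))
    (hchar : ringChar R ≠ ringChar F)
    (ξ : Eˣ →* Rˣ) (hξ : ∃ x : Eˣ, ξ x ≠ 1)
    (hξF : ∀ u : Fˣ, ξ (Units.map (algebraMap F E).toMonoidHom u) = 1)
    (ψ : AddChar F R) (hψ : ∃ x : F, ψ x ≠ 1)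
    (δ : Eˣ) (hδ : Algebra.trace F E (δ : E) = 0) :
    ∑ x : Eˣ, (((ξ x)⁻¹ : Rˣ) : R) * ψ (Algebra.trace F E (x : E))
      = (Fintype.card F : R) * ((ξ δ : Rˣ) : R) := by
  classical
  have hψ1 : ψ ≠ 1 := by
    rintro rfl
    simp at hψ
  let i : Fˣ →* Eˣ := Units.map (algebraMap F E).toMonoidHom
  have hi : Function.Injective i := Units.map_injective (algebraMap F E).injective
  have hle : i.range ≤ ξ.ker := by
    rintro _ ⟨u, rfl⟩
    exact hξF u
  let χ : Eˣ ⧸ i.range →* Rˣ := QuotientGroup.lift i.range ξ hle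
  have hχ (q : Eˣ ⧸ i.range) : ξ q.out = χ q := by
    conv_rhs => rw [← q.out_eq']
    rfl
  have hsum : ∑ q : Eˣ ⧸ i.range, (((χ q)⁻¹ : Rˣ) : R) = 0 := by
    refine sum_hom_units_eq_zero ((Units.coeHom R).comp χ⁻¹) fun h ↦ ?_
    obtain ⟨x, hx⟩ := hξ
    have := DFunLike.congr_fun h (x : Eˣ ⧸ i.range)
    simp [χ, hx] at this
  have htrace (q : Eˣ ⧸ i.range) :
      Algebra.trace F E (q.out : E) = 0 ↔ q = (δ : Eˣ ⧸ i.range) := by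
    constructor
    · intro hq
      obtain ⟨c, hc⟩ := exists_smul_eq_of_trace_eq_zero hquad δ.ne_zero hδ hq
      have hc0 : c ≠ 0 := by
        rintro rfl
        exact q.out.ne_zero (by simpa using hc.symm)
      rw [← q.out_eq', eq_comm]
      refine QuotientGroup.eq.mpr ⟨Units.mk0 c hc0, ?_⟩
      rw [eq_inv_mul_iff_mul_eq]
      ext
      simp [i, ← hc, Algebra.smul_def, mul_comm]
    · rintro rfl
      obtain ⟨⟨_, u, rfl⟩, hu⟩ := QuotientGroup.mk_out_eq_mul i.range δ
      have : ((δ * i u : Eˣ) : E) = (u : F) • (δ : E) := by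
        simp [i, Algebra.smul_def, mul_comm]
      rw [hu, this, map_smul, hδ, smul_zero]
  have hδ2 : (ξ δ)⁻¹ = ξ δ := by
    have hsq := sq_eq_algebraMap_of_trace_eq_zero hquad hδ
    have hn : -Algebra.norm F (δ : E) ≠ 0 :=
      neg_ne_zero.mpr (Algebra.norm_ne_zero_iff.mpr δ.ne_zero)
    have : δ * δ = i (Units.mk0 _ hn) := by
      ext
      simpa [i, pow_two] using hsq
    rw [inv_eq_iff_mul_eq_one, ← map_mul, this]
    exact hξF _
  have hinner (q : Eˣ ⧸ i.range) :
      ∑ u : Fˣ, (((ξ (q.out * i u))⁻¹ : Rˣ) : R) * ψ (Algebra.trace F E ((q.out * i u : Eˣ) : E))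
        = (((χ q)⁻¹ : Rˣ) : R) *
          ((if q = (δ : Eˣ ⧸ i.range) then (Fintype.card F : R) else 0) - 1) := by
    simp_rw [← htrace q]
    rw [← AddChar.sum_units_mul hψ1, Finset.mul_sum]
    refine Finset.sum_congr rfl fun u _ ↦ ?_
    have : ((q.out * i u : Eˣ) : E) = (u : F) • (q.out : E) := by
      simp [i, Algebra.smul_def, mul_comm]
    rw [this, map_smul, smul_eq_mul, map_mul, hχ, show ξ (i u) = 1 from hξF u, mul_one]
  rw [sum_eq_sum_quotient_range hi, Finset.sum_congr rfl fun q _ ↦ hinner q]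
  simp_rw [mul_sub, mul_one, Finset.sum_sub_distrib, hsum, mul_ite, mul_zero]
  rw [Finset.sum_ite_eq' Finset.univ, if_pos (Finset.mem_univ _), sub_zero, mul_comm,
    show χ (δ : Eˣ ⧸ i.range) = ξ δ from rfl, hδ2]
end
end

section
/- Inversion-invariance of double cosets for the twisted-linear subgroup: Let 𝒌 be a finite field with q elements, q odd, m ≥ 1, and fix α ∈ 𝒌^× which is not a square. Let H = { [[x, y],[αy, x]] (block form, x,y ∈ M_m(𝒌)) } ∩ GL_{2m}(𝒌), a subgroup of G = GL_{2m}(𝒌) isomorphic to GL_m of the quadratic extension 𝒌(√α). Then every (H,H)-double coset in G is stable under g ↦ g^{-1}; equivalently, for every g ∈ GL_{2m}(𝒌) there exist h1, h2 ∈ H with g^{-1} = h1·g·h2. -/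
open Matrix
noncomputable section

namespace Stmt17

variable {k : Type*} [Field k] [Fintype k] [DecidableEq k] {m : ℕ}

/-- Membership in the twisted-linear subgroup `H ≃ GL_m(𝒌(√α))` of `GL_{2m}(𝒌)`:
the invertible matrices of block form `[[x, y], [αy, x]]`. -/
def IsTwistedLinear (α : k) (h : GL (Fin m ⊕ Fin m) k) : Prop :=
  ∃ x y : Matrix (Fin m) (Fin m) k,
    (h : Matrix (Fin m ⊕ Fin m) (Fin m ⊕ Fin m) k) = Matrix.fromBlocks x y (α • y) x

/-- There is an automorphism commuting with `N` and anticommuting with `D`. -/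
def HasSwap {F V : Type*} [Field F] [AddCommGroup V] [Module F V] (N D : Module.End F V) : Prop :=
  ∃ s : V ≃ₗ[F] V, ∀ x, s (N x) = N (s x) ∧ s (D x) = -D (s x)

section LinearAlgebra

variable {F V : Type*} [Field F] [AddCommGroup V] [Module F V] {N D : Module.End F V}

theorem HasSwap.of_isCompl {U W : Submodule F V} (h : IsCompl U W)
    (hNU : ∀ x ∈ U, N x ∈ U) (hDU : ∀ x ∈ U, D x ∈ U)
    (hNW : ∀ x ∈ W, N x ∈ W) (hDW : ∀ x ∈ W, D x ∈ W)
    (hU : HasSwap (N.restrict hNU) (D.restrict hDU))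
    (hW : HasSwap (N.restrict hNW) (D.restrict hDW)) : HasSwap N D := by
  obtain ⟨s, hs⟩ := hU
  obtain ⟨t, ht⟩ := hW
  let e := Submodule.prodEquivOfIsCompl U W h
  let r : V ≃ₗ[F] V := e.symm ≪≫ₗ (s.prodCongr t) ≪≫ₗ e
  have he : ∀ (u : U) (w : W), e (u, w) = (u : V) + w := fun u w => by
    simp [e, Submodule.coe_prodEquivOfIsCompl']
  have hr : ∀ (u : U) (w : W), r ((u : V) + w) = s u + t w := fun u w => by
    rw [← he, ← he]
    simp [r]
  have hsurj : ∀ x : V, ∃ (u : U) (w : W), x = u + w := fun x =>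
    ⟨(e.symm x).1, (e.symm x).2, by rw [← he]; simp⟩
  refine ⟨r, fun x => ?_⟩
  obtain ⟨u, w, rfl⟩ := hsurj x
  have hN : N (u + w) = (N.restrict hNU u : V) + N.restrict hNW w := by simp
  have hD : D (u + w) = (D.restrict hDU u : V) + D.restrict hDW w := by simp
  rw [hN, hD, hr, hr, hr, (hs u).1, (hs u).2, (ht w).1, (ht w).2]
  constructor
  · simp
  · simp; abel

/-- The involution acting by `1` on `P` and by `-1` on `Q`. -/
theorem HasSwap.of_graded {P Q : Submodule F V} (h : IsCompl P Q)
    (hNP : ∀ x ∈ P, N x ∈ P) (hNQ : ∀ x ∈ Q, N x ∈ Q)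
    (hDP : ∀ x ∈ P, D x ∈ Q) (hDQ : ∀ x ∈ Q, D x ∈ P) : HasSwap N D := by
  let e := Submodule.prodEquivOfIsCompl P Q h
  let r : V ≃ₗ[F] V :=
    e.symm ≪≫ₗ ((LinearEquiv.refl F P).prodCongr (LinearEquiv.neg F)) ≪≫ₗ e
  have he : ∀ (u : P) (w : Q), e (u, w) = (u : V) + w := fun u w => by
    simp [e, Submodule.coe_prodEquivOfIsCompl']
  have hr : ∀ u ∈ P, ∀ w ∈ Q, r (u + w) = u - w := fun u hu w hw => by
    have h₁ := he ⟨u, hu⟩ ⟨w, hw⟩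
    have h₂ := he ⟨u, hu⟩ (-⟨w, hw⟩)
    simp only [Submodule.coe_neg] at h₁ h₂
    rw [sub_eq_add_neg, ← h₂, ← h₁]
    simp [r]
  have hsurj : ∀ x : V, ∃ u ∈ P, ∃ w ∈ Q, x = u + w := fun x =>
    ⟨(e.symm x).1, (e.symm x).1.2, (e.symm x).2, (e.symm x).2.2, by rw [← he]; simp⟩
  refine ⟨r, fun x => ?_⟩
  obtain ⟨u, hu, w, hw, rfl⟩ := hsurj x
  rw [map_add N, map_add D, hr _ (hNP u hu) _ (hNQ w hw), hr _ hu _ hw,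
    add_comm (D u), hr _ (hDQ w hw) _ (hDP u hu)]
  constructor <;> simp

theorem pow_apply_of_anticomm (hND : ∀ x, N (D x) = -D (N x)) (i : ℕ) (x : V) :
    (N ^ i) (D x) = ((-1 : F) ^ i) • D ((N ^ i) x) := by
  induction i with
  | zero => simp
  | succ i ih => simp [pow_succ', ih, hND]

theorem apply_pow_of_anticomm (hND : ∀ x, N (D x) = -D (N x)) (i : ℕ) (x : V) :
    D ((N ^ i) x) = ((-1 : F) ^ i) • (N ^ i) (D x) := by
  rw [pow_apply_of_anticomm hND, smul_smul, ← mul_pow]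
  simp

/-- The cyclic subspace generated by `v` under `N`. -/
def powSpan (N : Module.End F V) (v : V) : Submodule F V :=
  Submodule.span F (Set.range fun i : ℕ => (N ^ i) v)

theorem pow_mem_powSpan (N : Module.End F V) (v : V) (i : ℕ) : (N ^ i) v ∈ powSpan N v :=
  Submodule.subset_span ⟨i, rfl⟩

theorem powSpan_map_le {v : V} {f : V →ₗ[F] V} {P : Submodule F V}
    (h : ∀ i : ℕ, f ((N ^ i) v) ∈ P) : ∀ x ∈ powSpan N v, f x ∈ P := by
  have : powSpan N v ≤ P.comap f := by
    refine Submodule.span_le.2 ?_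
    rintro _ ⟨i, rfl⟩
    exact h i
  exact fun x hx => this hx

theorem apply_mem_powSpan (v : V) : ∀ x ∈ powSpan N v, N x ∈ powSpan N v :=
  powSpan_map_le fun i => by
    have := pow_mem_powSpan N v (i + 1)
    rwa [pow_succ'] at this

theorem exists_eq_smul_add_of_mem_powSpan {v x : V} (hx : x ∈ powSpan N v) :
    ∃ c : F, ∃ y ∈ powSpan N v, x = c • v + N y := by
  induction hx using Submodule.span_induction with
  | mem x hx =>
    obtain ⟨i, rfl⟩ := hx
    cases i with
    | zero => exact ⟨1, 0, zero_mem _, by simp⟩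
    | succ i => exact ⟨0, _, pow_mem_powSpan N v i, by simp [pow_succ']⟩
  | zero => exact ⟨0, 0, zero_mem _, by simp⟩
  | add x y _ _ hx hy =>
    obtain ⟨c, a, ha, rfl⟩ := hx
    obtain ⟨d, b, hb, rfl⟩ := hy
    exact ⟨c + d, a + b, add_mem ha hb, by rw [map_add, add_smul]; abel⟩
  | smul r x _ hx =>
    obtain ⟨c, a, ha, rfl⟩ := hx
    exact ⟨r * c, r • a, Submodule.smul_mem _ _ ha, by simp [mul_smul]⟩

/-- The largest subspace stable under `N` and `D` on which `f` vanishes. -/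
def stableKer (N D : Module.End F V) (f : V →ₗ[F] F) : Submodule F V where
  carrier := {x | ∀ i : ℕ, f ((N ^ i) x) = 0 ∧ f (D ((N ^ i) x)) = 0}
  add_mem' hx hy i := by simp [hx i, hy i]
  zero_mem' i := by simp
  smul_mem' c x hx i := by simp [hx i]

theorem apply_mem_stableKer {f : V →ₗ[F] F} :
    ∀ x ∈ stableKer N D f, N x ∈ stableKer N D f := fun x hx i => by
  have := hx (i + 1)
  rwa [pow_succ] at this

theorem apply_mem_stableKer' {β : F} (hND : ∀ x, N (D x) = -D (N x))
    (hsq : ∀ x, D (D x) = β • x - N (N x)) {f : V →ₗ[F] F} :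
    ∀ x ∈ stableKer N D f, D x ∈ stableKer N D f := fun x hx i => by
  have h := (hx (i + 2)).1
  rw [pow_succ', pow_succ'] at h
  simp only [Module.End.mul_apply] at h
  rw [pow_apply_of_anticomm hND]
  simp [hx i, hsq, h]

/-- In the nilpotent case, a vector of maximal height generates a graded summand. -/
theorem exists_graded_summand {β : F} (hβ : ¬ IsSquare β) (hND : ∀ x, N (D x) = -D (N x))
    (hsq : ∀ x, D (D x) = β • x - N (N x)) {n : ℕ} (hn : N ^ (n + 1) = 0)
    {v : V} (hv : (N ^ n) v ≠ 0) :
    ∃ U : Submodule F V, (∀ x ∈ U, N x ∈ U) ∧ (∀ x ∈ U, D x ∈ U) ∧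
      Disjoint (powSpan N v) (powSpan N (D v)) ∧
      IsCompl (powSpan N v ⊔ powSpan N (D v)) U := by
  have hβ0 : β ≠ 0 := by rintro rfl; exact hβ ⟨0, by simp⟩
  have hn' : ∀ x, N ((N ^ n) x) = 0 := fun x => by
    rw [← Module.End.mul_apply, ← pow_succ', hn, LinearMap.zero_apply]
  have hpow : ∀ i, n < i → N ^ i = 0 := fun i hi => pow_eq_zero_of_le hi hn
  set u := (N ^ n) v with hu
  have hDDu : D (D u) = β • u := by rw [hsq, hu, hn']; simp
  set ε : F := (-1) ^ n with hε
  have hεε : ε * ε = 1 := by rw [hε, ← mul_pow]; simp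
  have hε0 : ε ≠ 0 := left_ne_zero_of_mul_eq_one hεε
  set u' := (N ^ n) (D v) with hu'
  have hu'u : u' = ε • D u := pow_apply_of_anticomm hND n v
  have hmem : u ∉ Submodule.span F {u'} := by
    intro h
    obtain ⟨c, hc⟩ := Submodule.mem_span_singleton.1 h
    rw [hu'u, smul_smul] at hc
    have h₁ : ((c * ε) * (c * ε) * β) • u = u := by
      conv_rhs => rw [← hc, ← hc]
      simp only [map_smul, hDDu, smul_smul, mul_assoc]
    have h₂ : (c * ε) * (c * ε) * β = 1 := by
      by_contra hne
      have : ((c * ε) * (c * ε) * β - 1) • u = 0 := by rw [sub_smul, h₁]; simp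
      exact (smul_eq_zero.1 this).elim (fun h => hne (sub_eq_zero.1 h)) hv
    exact hβ ⟨(c * ε)⁻¹, by rw [← mul_inv]; exact eq_inv_of_mul_eq_one_right h₂⟩
  obtain ⟨f, hfu, hfu'⟩ : ∃ f : V →ₗ[F] F, f u = 1 ∧ f u' = 0 := by
    obtain ⟨f, hf, hle⟩ := Submodule.exists_le_ker_of_notMem hmem
    refine ⟨(f u)⁻¹ • f, by simp [hf], ?_⟩
    have : f u' = 0 := hle (Submodule.mem_span_singleton_self u')
    simp [this]
  set γ := f (D u') with hγ
  have hγ0 : γ ≠ 0 := by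
    rw [hγ, hu'u]
    simp [hDDu, hfu, hε0, hβ0]
  have key : ∀ a ∈ powSpan N v, ∀ b ∈ powSpan N (D v), a + b ∈ stableKer N D f →
      a = 0 ∧ b = 0 := by
    intro a ha b hb hab
    have step : ∀ j, j ≤ n + 1 → ∃ a' ∈ powSpan N v, ∃ b' ∈ powSpan N (D v),
        a = (N ^ j) a' ∧ b = (N ^ j) b' := by
      intro j
      induction j with
      | zero => exact fun _ => ⟨a, ha, b, hb, by simp, by simp⟩
      | succ j ih =>
        intro hj
        obtain ⟨a', ha', b', hb', haa, hbb⟩ := ih (by omega)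
        obtain ⟨c, a₁, ha₁, rfl⟩ := exists_eq_smul_add_of_mem_powSpan ha'
        obtain ⟨d, b₁, hb₁, rfl⟩ := exists_eq_smul_add_of_mem_powSpan hb'
        have hx : (N ^ (n - j)) (a + b) = c • u + d • u' := by
          have hcomb : N ^ (n - j) * N ^ j = N ^ n := by rw [← pow_add]; congr 1; omega
          have hz : ∀ x, (N ^ n) (N x) = 0 := fun x => by
            rw [← Module.End.mul_apply, ← pow_succ, hn, LinearMap.zero_apply]
          rw [haa, hbb, map_add, ← Module.End.mul_apply, ← Module.End.mul_apply, hcomb]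
          simp [hz, hu, hu']
        have h₁ := hab (n - j)
        rw [hx] at h₁
        obtain ⟨h₁, h₂⟩ := h₁
        have hc : c = 0 := by simpa [hfu, hfu'] using h₁
        have hd : d = 0 := by simpa [hc, ← hγ, hγ0] using h₂
        exact ⟨a₁, ha₁, b₁, hb₁, by simp [haa, hc, pow_succ], by simp [hbb, hd, pow_succ]⟩
    obtain ⟨a', -, b', -, h₁, h₂⟩ := step (n + 1) le_rfl
    exact ⟨by simp [h₁, hn], by simp [h₂, hn]⟩
  refine ⟨stableKer N D f, apply_mem_stableKer, apply_mem_stableKer' hND hsq, ?_, ?_, ?_⟩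
  · rw [Submodule.disjoint_def]
    intro x hx hx'
    refine (key x hx (-x) (neg_mem hx') ?_).1
    rw [add_neg_cancel]
    exact zero_mem _
  · rw [Submodule.disjoint_def]
    intro x hx hx'
    obtain ⟨a, ha, b, hb, rfl⟩ := Submodule.mem_sup.1 hx
    obtain ⟨rfl, rfl⟩ := key a ha b hb hx'
    simp
  · rw [codisjoint_iff, eq_top_iff]
    intro x _
    have step : ∀ j, j ≤ n + 1 → ∃ w ∈ powSpan N v ⊔ powSpan N (D v),
        ∀ i, n + 1 ≤ i + j → f ((N ^ i) (x - w)) = 0 ∧ f (D ((N ^ i) (x - w))) = 0 := by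
      intro j
      induction j with
      | zero => exact fun _ => ⟨0, zero_mem _, fun i hi => by simp [hpow i (by omega)]⟩
      | succ j ih =>
        intro hj
        obtain ⟨w, hw, hwi⟩ := ih (by omega)
        set y := x - w with hy
        set c := f ((N ^ (n - j)) y) with hc
        set d := (f (D ((N ^ (n - j)) y)) - c * f (D u)) / γ with hd
        refine ⟨w + (c • (N ^ j) v + d • (N ^ j) (D v)), add_mem hw (add_mem
          (Submodule.mem_sup_left (Submodule.smul_mem _ _ (pow_mem_powSpan N v j)))
          (Submodule.mem_sup_right (Submodule.smul_mem _ _ (pow_mem_powSpan N (D v) j)))),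
          fun i hi => ?_⟩
        rw [← sub_sub, ← hy]
        have hcomb : ∀ z, (N ^ i) ((N ^ j) z) = (N ^ (i + j)) z := fun z => by
          rw [← Module.End.mul_apply, ← pow_add]
        simp only [map_sub, map_add, map_smul, hcomb]
        rcases (show i + j = n ∨ n + 1 ≤ i + j by omega) with h | h
        · obtain rfl : i = n - j := by omega
          rw [h, ← hu, ← hu', hfu, hfu', ← hc, ← hγ]
          refine ⟨by simp, ?_⟩
          simp only [smul_eq_mul]
          rw [hd, div_mul_cancel₀ _ hγ0]
          ring
        · simp [hwi i h, hpow (i + j) (by omega)]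
    obtain ⟨w, hw, hwi⟩ := step (n + 1) le_rfl
    exact Submodule.mem_sup.2 ⟨w, hw, x - w, fun i => hwi i (by omega), by simp⟩

theorem hasSwap_of_isNilpotent {β : F} (hβ : ¬ IsSquare β) [FiniteDimensional F V]
    (hND : ∀ x, N (D x) = -D (N x)) (hsq : ∀ x, D (D x) = β • x - N (N x))
    (hN : IsNilpotent N) : HasSwap N D := by
  induction h : Module.finrank F V using Nat.strong_induction_on generalizing V with
  | _ d ih =>
  rcases subsingleton_or_nontrivial V with hV | hV
  · exact ⟨LinearEquiv.refl F V, fun x => ⟨Subsingleton.elim _ _, Subsingleton.elim _ _⟩⟩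
  obtain ⟨n, hn, hn'⟩ : ∃ n, N ^ (n + 1) = 0 ∧ N ^ n ≠ 0 := by
    obtain ⟨n, hn⟩ := Nat.exists_eq_succ_of_ne_zero (pos_nilpotencyClass_iff.2 hN).ne'
    exact ⟨n, by rw [← Nat.succ_eq_add_one, ← hn]; exact pow_nilpotencyClass hN,
      pow_pred_nilpotencyClass hN |> fun h => by rwa [hn] at h⟩
  obtain ⟨v, hv⟩ : ∃ v, (N ^ n) v ≠ 0 := by
    by_contra! h
    exact hn' (LinearMap.ext h)
  obtain ⟨U, hNU, hDU, hdisj, hcompl⟩ := exists_graded_summand hβ hND hsq hn hv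
  set P := powSpan N v
  set Q := powSpan N (D v)
  have hNP : ∀ x ∈ P, N x ∈ P := apply_mem_powSpan v
  have hNQ : ∀ x ∈ Q, N x ∈ Q := apply_mem_powSpan (D v)
  have hDP : ∀ x ∈ P, D x ∈ Q := powSpan_map_le fun i => by
    rw [apply_pow_of_anticomm hND]
    exact Submodule.smul_mem _ _ (pow_mem_powSpan N _ i)
  have hDQ : ∀ x ∈ Q, D x ∈ P := powSpan_map_le fun i => by
    rw [apply_pow_of_anticomm hND, hsq, map_sub, map_smul]
    refine Submodule.smul_mem _ _ (sub_mem (Submodule.smul_mem _ _ (pow_mem_powSpan N v i)) ?_)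
    exact pow_mem_powSpan N v (i + 2)
  have hNW : ∀ x ∈ P ⊔ Q, N x ∈ P ⊔ Q := fun x hx => by
    obtain ⟨a, ha, b, hb, rfl⟩ := Submodule.mem_sup.1 hx
    rw [map_add]
    exact Submodule.add_mem_sup (hNP a ha) (hNQ b hb)
  have hDW : ∀ x ∈ P ⊔ Q, D x ∈ P ⊔ Q := fun x hx => by
    obtain ⟨a, ha, b, hb, rfl⟩ := Submodule.mem_sup.1 hx
    rw [map_add, add_comm]
    exact Submodule.add_mem_sup (hDQ b hb) (hDP a ha)
  refine HasSwap.of_isCompl hcompl hNW hDW hNU hDU ?_ ?_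
  · refine HasSwap.of_graded (P := P.comap (P ⊔ Q).subtype) (Q := Q.comap (P ⊔ Q).subtype)
      ?_ (fun x hx => hNP x hx) (fun x hx => hNQ x hx) (fun x hx => hDP x hx)
      (fun x hx => hDQ x hx)
    constructor
    · rw [Submodule.disjoint_def]
      exact fun x hx hx' => Subtype.ext (Submodule.disjoint_def.1 hdisj x hx hx')
    · rw [codisjoint_iff, eq_top_iff]
      rintro ⟨x, hx⟩ -
      obtain ⟨a, ha, b, hb, rfl⟩ := Submodule.mem_sup.1 hx
      exact Submodule.mem_sup.2 ⟨⟨a, Submodule.mem_sup_left ha⟩, ha,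
        ⟨b, Submodule.mem_sup_right hb⟩, hb, rfl⟩
  · refine ih (Module.finrank F U) ?_ (fun x => Subtype.ext ?_) (fun x => Subtype.ext ?_) ?_ rfl
    · rw [← h]
      refine Submodule.finrank_lt fun hU => ?_
      have hvU : v ∈ U := hU ▸ Submodule.mem_top
      have hvP : v ∈ P ⊔ Q := Submodule.mem_sup_left (pow_mem_powSpan N v 0)
      have := Submodule.disjoint_def.1 hcompl.disjoint v hvP hvU
      simp [this] at hv
    · simp [hND]
    · simp [hsq]
    · refine ⟨n + 1, LinearMap.ext fun x => Subtype.ext ?_⟩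
      rw [Module.End.pow_restrict _ hNU]
      simp [hn]

theorem hasSwap_of_anticomm {β : F} (hβ : ¬ IsSquare β) [FiniteDimensional F V]
    (hND : ∀ x, N (D x) = -D (N x)) (hsq : ∀ x, D (D x) = β • x - N (N x)) :
    HasSwap N D := by
  obtain ⟨n, hn⟩ := Filter.eventually_atTop.1 N.eventually_isCompl_ker_pow_range_pow
  replace hn := hn (n + 1) (by omega)
  have hcomm : ∀ x, (N ^ (n + 1)) (N x) = N ((N ^ (n + 1)) x) := fun x => by
    rw [← Module.End.mul_apply, ← Module.End.mul_apply, ← pow_succ, ← pow_succ']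
  have hNR : ∀ x ∈ LinearMap.range (N ^ (n + 1)), N x ∈ LinearMap.range (N ^ (n + 1)) := by
    rintro _ ⟨x, rfl⟩
    exact ⟨N x, hcomm x⟩
  refine HasSwap.of_isCompl hn (fun x hx => ?_) (fun x hx => ?_) hNR ?_ ?_ ?_
  · rw [LinearMap.mem_ker] at hx ⊢
    rw [hcomm, hx, map_zero]
  · rw [LinearMap.mem_ker] at hx ⊢
    rw [pow_apply_of_anticomm hND, hx]
    simp
  · rintro _ ⟨x, rfl⟩
    rw [apply_pow_of_anticomm hND]
    exact Submodule.smul_mem _ _ ⟨D x, rfl⟩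
  · refine hasSwap_of_isNilpotent hβ (fun x => Subtype.ext ?_) (fun x => Subtype.ext ?_)
      ⟨n + 1, LinearMap.ext fun x => Subtype.ext ?_⟩
    · simp [hND]
    · simp [hsq]
    · rw [Module.End.pow_restrict]
      exact x.2
  · refine ⟨LinearEquiv.ofInjectiveEndo (N.restrict hNR) ?_, fun x => ⟨rfl, Subtype.ext ?_⟩⟩
    · rw [injective_iff_map_eq_zero]
      rintro ⟨x, hx⟩ h
      have h' : N x = 0 := congrArg Subtype.val h
      refine Subtype.ext (Submodule.disjoint_def.1 hn.disjoint x ?_ hx)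
      rw [LinearMap.mem_ker, pow_succ, Module.End.mul_apply, h', map_zero]
    · simp [hND]

end LinearAlgebra

theorem exists_swap_of_mul_self_eq {F ι : Type*} [Field F] [Fintype ι] [DecidableEq ι]
    (h2 : (2 : F) ≠ 0) {α : F} (hα : ¬ IsSquare α) {A B : Matrix ι ι F}
    (hA : A * A = α • 1) (hB : B * B = α • 1) :
    ∃ s : GL ι F, s.1 * A = B * s.1 ∧ s.1 * B = A * s.1 := by
  have h4 : ¬ IsSquare (4 * α) := by
    rintro ⟨r, hr⟩
    exact hα ⟨r / 2, by field_simp; linear_combination hr⟩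
  obtain ⟨s, hs⟩ := hasSwap_of_anticomm (N := Matrix.toLin' (A + B)) (D := Matrix.toLin' (A - B))
    h4 (fun x => by
      simp only [Matrix.toLin'_apply, Matrix.mulVec_mulVec, ← Matrix.neg_mulVec]
      congr 1
      simp only [add_mul, mul_sub, sub_mul, mul_add, hA, hB]
      abel) (fun x => by
      simp only [Matrix.toLin'_apply, Matrix.mulVec_mulVec]
      rw [← Matrix.one_mulVec ((4 * α) • x), Matrix.mulVec_smul, ← Matrix.smul_mulVec,
        ← Matrix.sub_mulVec]
      congr 1
      simp only [add_mul, mul_sub, sub_mul, mul_add, hA, hB]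
      module)
  let M : Matrix ι ι F := LinearMap.toMatrix' s.toLinearMap
  let M' : Matrix ι ι F := LinearMap.toMatrix' s.symm.toLinearMap
  have h₁ : M * M' = 1 := by
    rw [← LinearMap.toMatrix'_comp]
    simp
  have h₂ : M' * M = 1 := by
    rw [← LinearMap.toMatrix'_comp]
    simp
  have hN : M * (A + B) = (A + B) * M := by
    apply Matrix.toLin'.injective
    rw [Matrix.toLin'_mul, Matrix.toLin'_mul, Matrix.toLin'_toMatrix']
    exact LinearMap.ext fun x => (hs x).1
  have hD : M * (A - B) = -((A - B) * M) := by
    apply Matrix.toLin'.injective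
    rw [map_neg, Matrix.toLin'_mul, Matrix.toLin'_mul, Matrix.toLin'_toMatrix']
    exact LinearMap.ext fun x => (hs x).2
  refine ⟨⟨M, M', h₁, h₂⟩, ?_, ?_⟩ <;> apply smul_right_injective _ h2 <;>
    simp only [two_smul]
  · calc M * A + M * A = M * (A + B) + M * (A - B) := by noncomm_ring
      _ = B * M + B * M := by rw [hN, hD]; noncomm_ring
  · calc M * B + M * B = M * (A + B) - M * (A - B) := by noncomm_ring
      _ = A * M + A * M := by rw [hN, hD]; noncomm_ring

theorem isTwistedLinear_of_commute {F : Type*} [Field F] {n : ℕ} {α : F}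
    {h : GL (Fin n ⊕ Fin n) F}
    (hc : Commute h.1 (Matrix.fromBlocks 0 1 (α • 1) 0)) : IsTwistedLinear α h := by
  refine ⟨h.1.toBlocks₁₁, h.1.toBlocks₁₂, ?_⟩
  have hc := hc.eq
  rw [← Matrix.fromBlocks_toBlocks h.1] at hc
  simp only [Matrix.fromBlocks_multiply, Matrix.fromBlocks_inj] at hc
  obtain ⟨h₁, h₂, -, -⟩ := hc
  conv_lhs => rw [← Matrix.fromBlocks_toBlocks h.1]
  simp at h₁ h₂
  rw [h₁, h₂]

/-- **Inversion-invariance of double cosets for the twisted-linear subgroup.**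
For `q` odd and `α ∈ 𝒌^×` a non-square, every `(H,H)`-double coset in `GL_{2m}(𝒌)` is
stable under `g ↦ g⁻¹`: for every `g` there are `h₁, h₂ ∈ H` with `g⁻¹ = h₁ g h₂`. -/
theorem twisted_linear_double_cosets_inversion_stable
    (hq : Odd (Fintype.card k)) (α : k) (hα0 : α ≠ 0) (hα : ¬ IsSquare α)
    (g : GL (Fin m ⊕ Fin m) k) :
    ∃ h₁ h₂ : GL (Fin m ⊕ Fin m) k,
      IsTwistedLinear α h₁ ∧ IsTwistedLinear α h₂ ∧ g⁻¹ = h₁ * g * h₂ := by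
  have h2 : (2 : k) ≠ 0 := Ring.two_ne_zero fun h => by
    have := FiniteField.even_card_iff_char_two.1 h
    rw [Nat.odd_iff] at hq
    omega
  let J : Matrix (Fin m ⊕ Fin m) (Fin m ⊕ Fin m) k := Matrix.fromBlocks 0 1 (α • 1) 0
  have hJ : J * J = α • 1 := by
    simp [J, Matrix.fromBlocks_multiply, ← Matrix.fromBlocks_one, Matrix.fromBlocks_smul]
  have hgi : (g⁻¹).1 * g.1 = 1 := by rw [← Units.val_mul]; simp
  have hig : g.1 * (g⁻¹).1 = 1 := by rw [← Units.val_mul]; simp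
  have hB : (g.1 * J * (g⁻¹).1) * (g.1 * J * (g⁻¹).1) = α • 1 := by
    calc _ = g.1 * J * ((g⁻¹).1 * g.1) * J * (g⁻¹).1 := by noncomm_ring
      _ = g.1 * (J * J) * (g⁻¹).1 := by rw [hgi]; noncomm_ring
      _ = α • 1 := by rw [hJ, Matrix.mul_smul, Matrix.smul_mul, mul_one, hig]
  obtain ⟨s, hs, hs'⟩ := exists_swap_of_mul_self_eq h2 hα hJ hB
  have h₁ : Commute (s * g).1 J := by
    calc s.1 * g.1 * J = s.1 * (g.1 * J * ((g⁻¹).1 * g.1)) := by rw [hgi]; noncomm_ring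
      _ = s.1 * (g.1 * J * (g⁻¹).1) * g.1 := by noncomm_ring
      _ = J * (s.1 * g.1) := by rw [hs']; noncomm_ring
  have h₂ : Commute (g⁻¹ * s).1 J := by
    calc (g⁻¹).1 * s.1 * J = (g⁻¹).1 * (s.1 * J) := by noncomm_ring
      _ = ((g⁻¹).1 * g.1) * J * ((g⁻¹).1 * s.1) := by rw [hs]; noncomm_ring
      _ = J * ((g⁻¹).1 * s.1) := by rw [hgi, one_mul]
  exact ⟨(s * g)⁻¹, g⁻¹ * s, isTwistedLinear_of_commute h₁.units_inv_left,
    isTwistedLinear_of_commute h₂, by group⟩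

end Stmt17
end
end
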